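/- Let p be a prime, a_p(n) = ⌊n/(p−1)⌋ + v_p(⌊n/(p−1)⌋!), and b_p(n) = ⌊p·n/(p−1)² − 1/(p−1)⌋ (floor of the rational number, an integer). Then for every natural number n ≥ 1, one has a_p(n) ≤ b_p(n). -/

import Mathlib

/-- `a p n = ⌊n/(p−1)⌋ + v_p(⌊n/(p−1)⌋!)`, where `⌊·⌋` is natural division. -/
def apFun (p n : ℕ) : ℕ :=
  n / (p - 1) + padicValNat p (Nat.factorial (n / (p - 1)))

/-- `b p n = ⌊p·n/(p−1)² − 1/(p−1)⌋`, the floor of a rational number, as an integer. -/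
def bpFun (p n : ℕ) : ℤ :=
  ⌊(p : ℚ) * n / ((p : ℚ) - 1) ^ 2 - 1 / ((p : ℚ) - 1)⌋

theorem apFun_mul_sub_one_sq_add_le (p : ℕ) (hp : p.Prime) (n : ℕ) (hn : n ≥ 1) :
    apFun p n * (p - 1) ^ 2 + (p - 1) ≤ p * n := by
  have : Fact p.Prime := ⟨hp⟩
  obtain ⟨d, rfl⟩ : ∃ d, p = d + 1 := ⟨p - 1, by have := hp.pos; omega⟩
  have hdm : d * (n / d) ≤ n := Nat.mul_div_le n d
  unfold apFun
  simp only [Nat.add_sub_cancel]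
  generalize n / d = m at hdm ⊢
  rcases Nat.eq_zero_or_pos m with rfl | hm
  · simp
    nlinarith
  · have hv := sub_one_mul_padicValNat_factorial_lt_of_ne_zero (d + 1) hm.ne'
    rw [Nat.add_sub_cancel] at hv
    generalize padicValNat (d + 1) m.factorial = v at hv ⊢
    calc (m + v) * d ^ 2 + d = d * (m * d + (d * v + 1)) := by ring
      _ ≤ d * (m * d + m) := by gcongr; exact hv
      _ = (d + 1) * (d * m) := by ring
      _ ≤ (d + 1) * n := by gcongr

theorem apFun_le_bpFun (p : ℕ) (hp : p.Prime) (n : ℕ) (hn : n ≥ 1) :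
    (apFun p n : ℤ) ≤ bpFun p n := by
  have h := apFun_mul_sub_one_sq_add_le p hp n hn
  have hd : (0 : ℚ) < (p : ℚ) - 1 := sub_pos.mpr (by exact_mod_cast hp.one_lt)
  have hq : (apFun p n : ℚ) * ((p : ℚ) - 1) ^ 2 + ((p : ℚ) - 1) ≤ p * n := by
    rw [← Nat.cast_pred hp.pos]
    exact_mod_cast h
  have e : (p : ℚ) * n / ((p : ℚ) - 1) ^ 2 - 1 / ((p : ℚ) - 1) =
      (p * n - ((p : ℚ) - 1)) / ((p : ℚ) - 1) ^ 2 := by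
    field_simp
  rw [bpFun, Int.le_floor, Int.cast_natCast, e, le_div_iff₀ (by positivity)]
  linarith
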